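/- Let a and c be positive integers. There exists a co-polyunsaturated SGK graph G with independence number a and clique number c if and only if c ≥ a - 2. Moreover, G may be chosen so that both G and its complement are comparability graphs. -/

import Mathlib

/-- `s` is an independent set of the graph `G`. -/
def IndepSet {V : Type*} (G : SimpleGraph V) (s : Set V) : Prop :=
  ∀ ⦃v⦄, v ∈ s → ∀ ⦃w⦄, w ∈ s → ¬ G.Adj v w

/-- `α_k(G)`: the maximum number of vertices in a union of `k` independent sets. -/
noncomputable def alphak {V : Type*} (G : SimpleGraph V) (k : ℕ) : ℕ :=
  sSup {n | ∃ A : Fin k → Set V, (∀ i, IndepSet G (A i)) ∧ (⋃ i, A i).ncard = n}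

/-- `ω_k(G)`: the maximum number of vertices in a union of `k` cliques. -/
noncomputable def omegak {V : Type*} (G : SimpleGraph V) (k : ℕ) : ℕ :=
  sSup {n | ∃ A : Fin k → Set V, (∀ i, G.IsClique (A i)) ∧ (⋃ i, A i).ncard = n}

/-- The clique number `ω(G)`. -/
noncomputable def cliqueNumber {V : Type*} (G : SimpleGraph V) : ℕ :=
  sSup {n | ∃ s : Set V, G.IsClique s ∧ s.ncard = n}

/-- The independence number `α(G)`. -/
noncomputable def indepNumber {V : Type*} (G : SimpleGraph V) : ℕ :=
  sSup {n | ∃ s : Set V, IndepSet G s ∧ s.ncard = n}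

/-- `f` encodes a partition of the vertices of `G` into cliques:
its (nonempty) fibers are the cliques. -/
def IsCliquePartition {V : Type*} (G : SimpleGraph V) (f : V → V) : Prop :=
  ∀ i : V, G.IsClique (f ⁻¹' {i})

/-- The `k`-norm of the partition encoded by `f`: `Σ_C min (k, |C|)`. -/
noncomputable def knorm {V : Type*} [Fintype V] (f : V → V) (k : ℕ) : ℕ :=
  ∑ i : V, min k (f ⁻¹' {i}).ncard

/-- `G` is a strong Greene–Kleitman (SGK) graph: every induced subgraph has, for every
positive `k`, a clique partition that is simultaneously `k`- and `k+1`-saturated. -/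
def SGK {V : Type*} [Fintype V] (G : SimpleGraph V) : Prop :=
  ∀ (s : Finset V) (k : ℕ), 0 < k →
    ∃ f : (↑s : Set V) → (↑s : Set V),
      IsCliquePartition (G.induce ↑s) f ∧
      knorm f k = alphak (G.induce ↑s) k ∧
      knorm f (k + 1) = alphak (G.induce ↑s) (k + 1)

/-- An SGK graph is polyunsaturated if no clique partition is simultaneously `k`- and
`l`-saturated for distinct nonconsecutive positive `k, l` below the clique number. -/
def PolyunsatG {V : Type*} [Fintype V] (G : SimpleGraph V) : Prop :=
  ∀ k l : ℕ, 0 < k → 0 < l → k < cliqueNumber G → l < cliqueNumber G →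
    (k + 2 ≤ l ∨ l + 2 ≤ k) →
    ¬ ∃ f : V → V, IsCliquePartition G f ∧ knorm f k = alphak G k ∧ knorm f l = alphak G l

/-- `G` is a comparability graph: adjacency is comparability in some partial order. -/
def IsComparabilityGraph {V : Type*} (G : SimpleGraph V) : Prop :=
  ∃ r : V → V → Prop, IsPartialOrder V r ∧ ∀ v w, G.Adj v w ↔ (v ≠ w ∧ (r v w ∨ r w v))



open Finset

/-! ### Basic facts on `alphak`, `knorm` and the clique and independence numbers -/

section Basics

variable {V W : Type*}

theorem bddAbove_alphak [Finite V] (G : SimpleGraph V) (k : ℕ) :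
    BddAbove {n | ∃ A : Fin k → Set V, (∀ i, IndepSet G (A i)) ∧ (⋃ i, A i).ncard = n} := by
  refine ⟨Nat.card V, ?_⟩
  rintro n ⟨A, -, rfl⟩
  exact Set.ncard_le_card _

theorem le_alphak [Finite V] {G : SimpleGraph V} {k : ℕ} {A : Fin k → Set V}
    (hA : ∀ i, IndepSet G (A i)) : (⋃ i, A i).ncard ≤ alphak G k :=
  le_csSup (bddAbove_alphak G k) ⟨A, hA, rfl⟩

theorem exists_alphak [Finite V] (G : SimpleGraph V) (k : ℕ) :
    ∃ A : Fin k → Set V, (∀ i, IndepSet G (A i)) ∧ (⋃ i, A i).ncard = alphak G k := by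
  refine Nat.sSup_mem ?_ (bddAbove_alphak G k)
  exact ⟨_, fun _ => ∅, fun _ v hv => hv.elim, rfl⟩

theorem bddAbove_cliqueNumber [Finite V] (G : SimpleGraph V) :
    BddAbove {n | ∃ s : Set V, G.IsClique s ∧ s.ncard = n} := by
  refine ⟨Nat.card V, ?_⟩
  rintro n ⟨A, -, rfl⟩
  exact Set.ncard_le_card _

theorem le_cliqueNumber [Finite V] {G : SimpleGraph V} {s : Set V} (hs : G.IsClique s) :
    s.ncard ≤ cliqueNumber G :=
  le_csSup (bddAbove_cliqueNumber G) ⟨s, hs, rfl⟩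

theorem exists_cliqueNumber [Finite V] (G : SimpleGraph V) :
    ∃ s : Set V, G.IsClique s ∧ s.ncard = cliqueNumber G := by
  refine Nat.sSup_mem ?_ (bddAbove_cliqueNumber G)
  exact ⟨_, ∅, by simp, rfl⟩

theorem indepSet_iff_isClique_compl {G : SimpleGraph V} {s : Set V} :
    IndepSet G s ↔ Gᶜ.IsClique s := by
  constructor
  · intro h v hv w hw hne
    exact (SimpleGraph.compl_adj _ _ _).2 ⟨hne, h hv hw⟩
  · intro h v hv w hw hadj
    exact ((SimpleGraph.compl_adj _ _ _).1 (h hv hw hadj.ne)).2 hadj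

theorem indepNumber_eq_cliqueNumber_compl (G : SimpleGraph V) :
    indepNumber G = cliqueNumber Gᶜ := by
  simp only [indepNumber, cliqueNumber, indepSet_iff_isClique_compl]

theorem cliqueNumber_eq_indepNumber_compl (G : SimpleGraph V) :
    cliqueNumber G = indepNumber Gᶜ := by
  rw [indepNumber_eq_cliqueNumber_compl, compl_compl]

theorem alphak_one (G : SimpleGraph V) : alphak G 1 = indepNumber G := by
  unfold alphak indepNumber
  congr 1
  ext n
  constructor
  · rintro ⟨A, hA, rfl⟩
    exact ⟨A 0, hA 0, congrArg Set.ncard (ciSup_unique (s := A)).symm⟩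
  · rintro ⟨s, hs, rfl⟩
    exact ⟨fun _ => s, fun _ => hs, by rw [Set.iUnion_const]⟩

theorem alphak_le_of_iso {G : SimpleGraph V} {H : SimpleGraph W} [Finite W] [Finite V]
    (e : G ≃g H) (k : ℕ) : alphak G k ≤ alphak H k := by
  obtain ⟨A, hA, h⟩ := exists_alphak G k
  rw [← h, ← Set.ncard_image_of_injective _ e.injective, Set.image_iUnion]
  refine le_alphak fun i => ?_
  rintro _ ⟨v, hv, rfl⟩ _ ⟨w, hw, rfl⟩ hadj
  exact hA i hv hw (e.map_adj_iff.1 hadj)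

theorem alphak_iso {G : SimpleGraph V} {H : SimpleGraph W} [Finite W] [Finite V]
    (e : G ≃g H) (k : ℕ) : alphak G k = alphak H k :=
  (alphak_le_of_iso e k).antisymm (alphak_le_of_iso e.symm k)

theorem cliqueNumber_le_of_iso {G : SimpleGraph V} {H : SimpleGraph W} [Finite W] [Finite V]
    (e : G ≃g H) : cliqueNumber G ≤ cliqueNumber H := by
  obtain ⟨s, hs, h⟩ := exists_cliqueNumber G
  rw [← h, ← Set.ncard_image_of_injective _ e.injective]
  refine le_cliqueNumber ?_
  rintro _ ⟨v, hv, rfl⟩ _ ⟨w, hw, rfl⟩ hne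
  exact e.map_adj_iff.2 (hs hv hw fun h => hne (by rw [h]))

theorem cliqueNumber_iso {G : SimpleGraph V} {H : SimpleGraph W} [Finite W] [Finite V]
    (e : G ≃g H) : cliqueNumber G = cliqueNumber H :=
  (cliqueNumber_le_of_iso e).antisymm (cliqueNumber_le_of_iso e.symm)

theorem ncard_fiber [Fintype V] [DecidableEq W] (f : V → W) (i : W) :
    (f ⁻¹' {i}).ncard = #{v | f v = i} := by
  rw [← Set.ncard_coe_finset]
  congr 1
  ext v
  simp

theorem preimage_conj_singleton (e : V ≃ W) (f : V → V) (j : W) :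
    (e ∘ f ∘ e.symm) ⁻¹' {j} = e '' (f ⁻¹' {e.symm j}) := by
  ext w
  simp [Equiv.eq_symm_apply]

theorem knorm_conj [Fintype V] [Fintype W] (e : V ≃ W) (f : V → V) (k : ℕ) :
    knorm (e ∘ f ∘ e.symm) k = knorm f k := by
  unfold knorm
  rw [← e.sum_comp]
  refine Finset.sum_congr rfl fun i _ => ?_
  rw [preimage_conj_singleton, Set.ncard_image_of_injective _ e.injective, e.symm_apply_apply]

theorem IsCliquePartition.conj {G : SimpleGraph V} {H : SimpleGraph W} (e : G ≃g H) {f : V → V}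
    (hf : IsCliquePartition G f) : IsCliquePartition H (e ∘ f ∘ e.symm) := by
  intro j
  have := preimage_conj_singleton e.toEquiv f j
  change H.IsClique ((e.toEquiv ∘ f ∘ e.toEquiv.symm) ⁻¹' {j})
  rw [this]
  rintro _ ⟨v, hv, rfl⟩ _ ⟨w, hw, rfl⟩ hne
  exact e.map_adj_iff.2 (hf _ hv hw fun h => hne (by rw [h]))

theorem PolyunsatG.iso [Fintype V] [Fintype W] {G : SimpleGraph V} {H : SimpleGraph W}
    (e : G ≃g H) (hG : PolyunsatG G) : PolyunsatG H := by
  intro k l hk hl hkc hlc hkl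
  rw [← cliqueNumber_iso e] at hkc hlc
  rintro ⟨f, hf, h1, h2⟩
  refine hG k l hk hl hkc hlc hkl ⟨_, hf.conj e.symm, ?_, ?_⟩
  · rw [alphak_iso e, ← h1]
    exact knorm_conj e.toEquiv.symm f k
  · rw [alphak_iso e, ← h2]
    exact knorm_conj e.toEquiv.symm f l

theorem IsComparabilityGraph.of_embedding {G : SimpleGraph V} {H : SimpleGraph W}
    (e : G ↪g H) (hH : IsComparabilityGraph H) : IsComparabilityGraph G := by
  obtain ⟨r, hr, hadj⟩ := hH
  refine ⟨fun v w => r (e v) (e w), ?_, fun v w => ?_⟩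
  · exact
      { refl := fun v => hr.refl _
        trans := fun u v w => hr.trans _ _ _
        antisymm := fun u v h h' => e.injective (hr.antisymm _ _ h h') }
  · rw [← e.map_adj_iff, hadj, e.injective.ne_iff]

theorem isComparabilityGraph_of_strict {G : SimpleGraph V} (lt : V → V → Prop)
    (irrefl : ∀ v, ¬ lt v v) (trans : ∀ u v w, lt u v → lt v w → lt u w)
    (hadj : ∀ v w, G.Adj v w ↔ lt v w ∨ lt w v) : IsComparabilityGraph G := by
  refine ⟨fun v w => v = w ∨ lt v w, ?_, fun v w => ?_⟩
  · refine
      { refl := fun v => Or.inl rfl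
        trans := ?_
        antisymm := ?_ }
    · rintro u v w (rfl | h) (rfl | h')
      exacts [Or.inl rfl, Or.inr h', Or.inr h, Or.inr (trans _ _ _ h h')]
    · rintro u v (rfl | h) (h' | h')
      exacts [rfl, rfl, h'.symm, (irrefl _ (trans _ _ _ h h')).elim]
  · rw [hadj]
    constructor
    · intro h
      refine ⟨?_, by tauto⟩
      rintro rfl
      exact irrefl v (by tauto)
    · rintro ⟨hne, (h | h) | (h | h)⟩ <;> first | exact absurd h hne | exact absurd h.symm hne | tauto

theorem IsComparabilityGraph.exists_strict {G : SimpleGraph V} (hG : IsComparabilityGraph G) :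
    ∃ lt : V → V → Prop, (∀ v, ¬ lt v v) ∧ (∀ u v w, lt u v → lt v w → lt u w) ∧
      ∀ v w, G.Adj v w ↔ lt v w ∨ lt w v := by
  obtain ⟨r, hr, hadj⟩ := hG
  refine ⟨fun v w => v ≠ w ∧ r v w, fun v h => h.1 rfl, ?_, fun v w => ?_⟩
  · rintro u v w ⟨h, h1⟩ ⟨h', h2⟩
    refine ⟨?_, hr.trans _ _ _ h1 h2⟩
    rintro rfl
    exact h (hr.antisymm _ _ h1 h2)
  · have := ne_comm (a := v) (b := w)
    rw [hadj]
    tauto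

/-- A clique meets a union of `k` independent sets in at most `k` vertices. -/
theorem card_inter_le_of_isClique {G : SimpleGraph V} {k : ℕ} {A : Fin k → Set V}
    (hA : ∀ i, IndepSet G (A i)) {D : Finset V} (hD : G.IsClique (D : Set V))
    (hDA : ∀ v ∈ D, v ∈ ⋃ i, A i) : #D ≤ k := by
  have : ∀ v : D, ∃ i, (v : V) ∈ A i := fun v => Set.mem_iUnion.1 (hDA v v.2)
  choose c hc using this
  have hinj : Function.Injective c := by
    intro v w h
    by_contra hne
    refine hA (c v) (hc v) (h ▸ hc w) (hD v.2 w.2 fun h' => hne (Subtype.ext h'))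
  simpa using Fintype.card_le_of_injective c hinj

/-- Bounding `alphak` through a colouring of the vertices: if a union of `k` independent sets
contains at most `β c` vertices of each colour `c`, then it has at most `∑ c, β c` vertices. -/
theorem alphak_le_sum {ι : Type*} [Fintype ι] [DecidableEq ι] [Fintype V] {G : SimpleGraph V}
    {k : ℕ} (κ : V → ι) (β : ι → ℕ)
    (h : ∀ A : Fin k → Set V, (∀ i, IndepSet G (A i)) → ∀ c, ∀ D : Finset V,
      (∀ v ∈ D, v ∈ ⋃ i, A i) → (∀ v ∈ D, κ v = c) → #D ≤ β c) :
    alphak G k ≤ ∑ c, β c := by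
  classical
  obtain ⟨A, hA, hk⟩ := exists_alphak G k
  rw [← hk, Set.ncard_eq_toFinset_card',
    Finset.card_eq_sum_card_fiberwise (f := κ) (t := univ) (fun _ _ => by simp)]
  refine Finset.sum_le_sum fun c _ => h A hA c _ ?_ ?_ <;> simp +contextual

theorem alphak_le_knorm [Fintype V] {G : SimpleGraph V} {f : V → V}
    (hf : IsCliquePartition G f) (k : ℕ) : alphak G k ≤ knorm f k := by
  classical
  refine alphak_le_sum f _ fun A hA c D hDA hDc => le_min ?_ ?_
  · exact card_inter_le_of_isClique hA
      (fun v hv w hw => hf c (by simpa using hDc v hv) (by simpa using hDc w hw)) hDA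
  · rw [ncard_fiber]
    exact Finset.card_le_card fun v hv => by simpa using hDc v hv

end Basics

/-! ### The Greene–Kleitman theorem -/

section GreeneKleitman

variable {V : Type*} [Fintype V]

/-- Duality for the assignment problem. -/
theorem exists_potentials_and_assignment [DecidableEq V] (w : V → V → ℤ) :
    ∃ a b : V → ℤ, (∀ u v, w u v ≤ a u + b v) ∧
      ∃ σ : Equiv.Perm V, ∀ u, w u (σ u) = a u + b (σ u) := by
  obtain ⟨⟨a, b⟩, hab, hmin⟩ : ∃ p : (V → ℤ) × (V → ℤ), (∀ u v, w u v ≤ p.1 u + p.2 v) ∧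
      ∀ q : (V → ℤ) × (V → ℤ), (∀ u v, w u v ≤ q.1 u + q.2 v) →
        ∑ v, (p.1 v + p.2 v) ≤ ∑ v, (q.1 v + q.2 v) := by
    let S : Set ((V → ℤ) × (V → ℤ)) := {p | ∀ u v, w u v ≤ p.1 u + p.2 v}
    let g : (V → ℤ) × (V → ℤ) → ℕ := fun p => (∑ v, (p.1 v + p.2 v - w v v)).toNat
    have hg : ∀ p ∈ S, (g p : ℤ) = ∑ v, (p.1 v + p.2 v) - ∑ v, w v v := by
      intro p hp
      rw [← Finset.sum_sub_distrib]
      exact Int.toNat_of_nonneg (Finset.sum_nonneg fun v _ => sub_nonneg.2 (hp v v))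
    have hne : S.Nonempty := by
      refine ⟨(fun u => ∑ v, |w u v|, fun _ => 0), fun u v => ?_⟩
      have := Finset.single_le_sum (f := fun v => |w u v|) (fun v _ => abs_nonneg _)
        (Finset.mem_univ v)
      have h2 := le_abs_self (w u v)
      simp only [add_zero]
      exact h2.trans this
    obtain ⟨p, hp, hpm⟩ := exists_minimalFor_of_wellFoundedLT (· ∈ S) g hne
    refine ⟨p, hp, fun q hq => ?_⟩
    have h1 : g p ≤ g q := (le_total (g p) (g q)).elim id fun h => hpm hq h
    have h2 := hg p hp
    have h3 := hg q hq
    omega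
  refine ⟨a, b, hab, ?_⟩
  let t : V → Finset V := fun u => {v | w u v = a u + b v}
  obtain ⟨σ, hσ, hσt⟩ : ∃ σ : V → V, Function.Injective σ ∧ ∀ u, σ u ∈ t u := by
    rw [← Finset.all_card_le_biUnion_card_iff_exists_injective]
    intro s
    by_contra! hlt
    have := hmin (fun u => a u - if u ∈ s then 1 else 0,
      fun v => b v + if v ∈ s.biUnion t then 1 else 0) ?_
    · simp only [Finset.sum_add_distrib, Finset.sum_sub_distrib, Finset.sum_ite_mem,
        Finset.univ_inter, Finset.sum_const, nsmul_eq_mul, mul_one] at this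
      omega
    · intro u v
      have h : w u v ≤ a u + b v := hab u v
      by_cases hu : u ∈ s
      · by_cases hv : v ∈ s.biUnion t
        · simp only [if_pos hu, if_pos hv]; omega
        · have : w u v ≠ a u + b v := fun h' =>
            hv (Finset.mem_biUnion.2 ⟨u, hu, by simpa [t] using h'⟩)
          simp only [if_pos hu, if_neg hv]; omega
      · simp only [if_neg hu]
        split_ifs <;> omega
  refine ⟨Equiv.ofBijective σ (Finite.injective_iff_bijective.1 hσ), fun u => ?_⟩
  simpa [t] using hσt u

variable {lt : V → V → Prop}

/-- Follow the links `v → σ v` of a permutation that go up in a strict order. -/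
theorem exists_chain_end (irrefl : ∀ v, ¬ lt v v) (trans : ∀ u v w, lt u v → lt v w → lt u w)
    (σ : V → V) (v : V) :
    ∃ e, ¬ lt e (σ e) ∧ ∃ n, σ^[n] v = e ∧ ∀ j ≤ n, j = 0 ∨ lt v (σ^[j] v) := by
  have wf : WellFounded (fun x y => lt y x) := by
    have : Std.Irrefl (fun x y => lt y x) := ⟨irrefl⟩
    have : IsTrans V (fun x y => lt y x) := ⟨fun a b c h h' => trans _ _ _ h' h⟩
    exact Finite.wellFounded_of_trans_of_irrefl _
  induction v using wf.induction with
  | _ v ih =>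
    by_cases hv : lt v (σ v)
    · obtain ⟨e, he, n, hn, hj⟩ := ih (σ v) hv
      refine ⟨e, he, n + 1, hn, fun j hjn => ?_⟩
      cases j with
      | zero => exact Or.inl rfl
      | succ j =>
        right
        rcases hj j (by omega) with rfl | h
        · exact hv
        · exact trans _ _ _ hv h
    · exact ⟨v, hv, 0, rfl, fun j hj => Or.inl (by omega)⟩

/-- The partition into the chains formed by the upward links of a permutation. -/
theorem exists_chain_partition (irrefl : ∀ v, ¬ lt v v)
    (trans : ∀ u v w, lt u v → lt v w → lt u w) (σ : Equiv.Perm V) :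
    ∃ f : V → V, (∀ u v, f u = f v → u = v ∨ lt u v ∨ lt v u) ∧
      (∀ v, ¬ lt (f v) (σ (f v))) ∧ ∀ v, σ (f v) = f v → v = f v := by
  choose f hf n hn hj using exists_chain_end irrefl trans σ
  have key : ∀ u v, n u ≤ n v → f u = f v → u = v ∨ lt v u := by
    intro u v hle h
    rw [← hn u, ← hn v] at h
    have h2 : n v = n u + (n v - n u) := by omega
    rw [h2, Function.iterate_add_apply] at h
    have h3 := σ.injective.iterate _ h
    rcases hj v (n v - n u) (by omega) with h4 | h4
    · rw [h4] at h3
      exact Or.inl h3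
    · rw [← h3] at h4
      exact Or.inr h4
  refine ⟨f, fun u v h => ?_, hf, fun v h => ?_⟩
  · rcases le_total (n u) (n v) with hle | hle
    · rcases key u v hle h with h | h <;> tauto
    · rcases key v u hle h.symm with h | h
      · exact Or.inl h.symm
      · tauto
  · apply σ.injective.iterate (n v)
    rw [hn v, Function.iterate_fixed h]

/-- Dual side: potentials for the weights `2 * k + 1` on comparable pairs and `2 * k - 1` on the
diagonal yield a union of `k + 1` and a union of `k` independent sets. -/
theorem sum_potentials_le_alphak [DecidableEq V] {G : SimpleGraph V}
    (hadj : ∀ v w, G.Adj v w ↔ lt v w ∨ lt w v) (k : ℕ) (a b : V → ℤ)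
    (ha : ∀ v, 0 ≤ a v) (hb : ∀ v, 0 ≤ b v)
    (hlt : ∀ u v, lt u v → 2 * (k : ℤ) + 1 ≤ a u + b v)
    (hd : ∀ v, 2 * (k : ℤ) - 1 ≤ a v + b v) :
    ∑ v, (2 * (k : ℤ) + 1 - a v - b v) ≤ alphak G k + alphak G (k + 1) := by
  let lev : ℤ → Set V := fun t => {v | b v < t ∧ t + a v ≤ 2 * k + 1}
  have hlev : ∀ t, IndepSet G (lev t) := by
    intro t u hu v hv hadj'
    simp only [lev, Set.mem_ofPred_eq] at hu hv
    rcases (hadj u v).1 hadj' with h | h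
    · have := hlt _ _ h
      omega
    · have := hlt _ _ h
      omega
  have hE := le_alphak (G := G) (A := fun i : Fin k => lev (2 * i + 2)) fun i => hlev _
  have hO := le_alphak (G := G) (A := fun i : Fin (k + 1) => lev (2 * i + 1)) fun i => hlev _
  set E := ⋃ i : Fin k, lev (2 * i + 2) with hEdef
  set O := ⋃ i : Fin (k + 1), lev (2 * i + 1) with hOdef
  have memE : ∀ v, ∀ i : ℕ, i < k → b v < 2 * i + 2 → 2 * i + 2 + a v ≤ 2 * k + 1 → v ∈ E :=
    fun v i hi h1 h2 => Set.mem_iUnion.2 ⟨⟨i, hi⟩, h1, h2⟩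
  have memO : ∀ v, ∀ i : ℕ, i < k + 1 → b v < 2 * i + 1 → 2 * i + 1 + a v ≤ 2 * k + 1 → v ∈ O :=
    fun v i hi h1 h2 => Set.mem_iUnion.2 ⟨⟨i, hi⟩, h1, h2⟩
  classical
  have hpt : ∀ v, 2 * (k : ℤ) + 1 - a v - b v ≤
      (if v ∈ E then 1 else 0) + (if v ∈ O then 1 else 0) := by
    intro v
    have h1 := ha v
    have h2 := hb v
    have h3 := hd v
    have hE0 : (0 : ℤ) ≤ if v ∈ E then 1 else 0 := by split_ifs <;> simp
    have hO0 : (0 : ℤ) ≤ if v ∈ O then 1 else 0 := by split_ifs <;> simp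
    have hE1 : v ∈ E → (if v ∈ E then (1 : ℤ) else 0) = 1 := fun h => if_pos h
    have hO1 : v ∈ O → (if v ∈ O then (1 : ℤ) else 0) = 1 := fun h => if_pos h
    by_contra! hcon
    generalize (if v ∈ E then (1 : ℤ) else 0) = δE at *
    generalize (if v ∈ O then (1 : ℤ) else 0) = δO at *
    obtain ⟨c, hc⟩ := Int.eq_ofNat_of_zero_le h2
    rcases Nat.even_or_odd' c with ⟨i, hi | hi⟩
    · have hO' : 0 < 2 * (k : ℤ) + 1 - a v - b v → v ∈ O := fun h =>
        memO v i (by omega) (by omega) (by omega)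
      have hE' : 1 < 2 * (k : ℤ) + 1 - a v - b v → v ∈ E := fun h =>
        memE v i (by omega) (by omega) (by omega)
      have h5 := fun h => hO1 (hO' h)
      have h6 := fun h => hE1 (hE' h)
      omega
    · have hE' : 0 < 2 * (k : ℤ) + 1 - a v - b v → v ∈ E := fun h =>
        memE v i (by omega) (by omega) (by omega)
      have hO' : 1 < 2 * (k : ℤ) + 1 - a v - b v → v ∈ O := fun h =>
        memO v (i + 1) (by omega) (by push_cast; omega) (by push_cast; omega)
      have h5 := fun h => hO1 (hO' h)
      have h6 := fun h => hE1 (hE' h)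
      omega
  have hcard : ∀ S : Set V, ∑ v, (if v ∈ S then (1 : ℤ) else 0) = (S.ncard : ℤ) := by
    intro S
    rw [Set.ncard_eq_toFinset_card', Finset.sum_boole]
    congr 2
    ext v
    simp
  refine (Finset.sum_le_sum fun v _ => hpt v).trans ?_
  rw [Finset.sum_add_distrib, hcard, hcard]
  exact_mod_cast Nat.add_le_add hE hO

/-- The **Greene–Kleitman theorem**: a finite poset has, for each `k > 0`, a chain partition that is
simultaneously `k`- and `(k + 1)`-saturated. -/
theorem IsComparabilityGraph.exists_saturated {G : SimpleGraph V} (hG : IsComparabilityGraph G)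
    {k : ℕ} (hk : 0 < k) : ∃ f : V → V, IsCliquePartition G f ∧ knorm f k = alphak G k ∧
      knorm f (k + 1) = alphak G (k + 1) := by
  classical
  obtain ⟨lt, irrefl, trans, hadj⟩ := hG.exists_strict
  let w : V → V → ℤ := fun u v => if lt u v then 2 * k + 1 else if u = v then 2 * k - 1 else 0
  obtain ⟨a, b, hab, σ, hσ⟩ := exists_potentials_and_assignment w
  obtain ⟨β, hβa, hβb⟩ : ∃ β : ℤ, (∀ v, 0 ≤ a v + β) ∧ ∀ v, 0 ≤ b v - β := by
    cases isEmpty_or_nonempty V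
    · exact ⟨0, fun v => isEmptyElim v, fun v => isEmptyElim v⟩
    · obtain ⟨v₀, hv₀⟩ := Finite.exists_min b
      refine ⟨b v₀, fun v => le_trans ?_ (hab v v₀), fun v => sub_nonneg.2 (hv₀ v)⟩
      simp only [w]
      split_ifs <;> omega
  have hdual := sum_potentials_le_alphak hadj k (fun v => a v + β) (fun v => b v - β) hβa hβb
    (fun u v h => by have := hab u v; simp only [w, if_pos h] at this; omega)
    (fun v => by have := hab v v; simp only [w, if_neg (irrefl v), if_true] at this; omega)
  obtain ⟨f, hf, hend, hfix⟩ := exists_chain_partition irrefl trans σ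
  have hpart : IsCliquePartition G f := by
    intro i u hu v hv hne
    rw [hadj]
    have := hf u v (hu.trans hv.symm)
    tauto
  have hle := alphak_le_knorm hpart k
  have hle' := alphak_le_knorm hpart (k + 1)
  have hprimal : ((knorm f k + knorm f (k + 1) : ℕ) : ℤ) ≤ ∑ v, (2 * (k : ℤ) + 1 - w v (σ v)) := by
    unfold knorm
    rw [← Finset.sum_add_distrib, Nat.cast_sum]
    refine Finset.sum_le_sum fun i _ => ?_
    simp only [w]
    split_ifs with h1 h2
    · have : f ⁻¹' {i} = ∅ := by
        ext v
        simp only [Set.mem_preimage, Set.mem_singleton_iff, Set.mem_empty_iff_false, iff_false]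
        rintro rfl
        exact hend v h1
      simp [this]
    · have : f ⁻¹' {i} ⊆ {i} := by
        rintro v rfl
        exact hfix v h2.symm
      have := Set.ncard_le_ncard this
      rw [Set.ncard_singleton] at this
      omega
    · omega
  have hsum : ∑ v, (2 * (k : ℤ) + 1 - w v (σ v)) =
      ∑ v, (2 * (k : ℤ) + 1 - (a v + β) - (b v - β)) := by
    simp only [hσ, Finset.sum_sub_distrib, Finset.sum_add_distrib]
    rw [Equiv.sum_comp σ b]
    ring
  rw [← hsum] at hdual
  have := hprimal.trans hdual
  refine ⟨f, hpart, ?_, ?_⟩ <;> omega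

theorem IsComparabilityGraph.sgk {G : SimpleGraph V} (hG : IsComparabilityGraph G) : SGK G :=
  fun s _ hk => (hG.of_embedding (SimpleGraph.Embedding.induce (s : Set V))).exists_saturated hk

end GreeneKleitman

section Necessity

variable {V : Type*} [Fintype V]

theorem SGK.exists_saturated {G : SimpleGraph V} (hG : SGK G) {k : ℕ} (hk : 0 < k) :
    ∃ f : V → V, IsCliquePartition G f ∧ knorm f k = alphak G k ∧
      knorm f (k + 1) = alphak G (k + 1) := by
  obtain ⟨f, hf, h1, h2⟩ := hG univ k hk
  let e : G.induce ((univ : Finset V) : Set V) ≃g G :=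
    { toEquiv := Equiv.subtypeUnivEquiv (by simp)
      map_rel_iff' := Iff.rfl }
  refine ⟨_, hf.conj e, ?_, ?_⟩
  · rw [← alphak_iso e, ← h1]
    exact knorm_conj e.toEquiv f k
  · rw [← alphak_iso e, ← h2]
    exact knorm_conj e.toEquiv f (k + 1)

/-- The `k`-norm of a partition is concave in `k`. -/
theorem knorm_concave (f : V → V) (k : ℕ) :
    knorm f (k + 2) + knorm f k ≤ 2 * knorm f (k + 1) := by
  unfold knorm
  rw [← Finset.sum_add_distrib, Finset.mul_sum]
  exact Finset.sum_le_sum fun i _ => by omega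

theorem alphak_lt_succ {G : SimpleGraph V} {k : ℕ} (hk : k < cliqueNumber G) :
    alphak G k + 1 ≤ alphak G (k + 1) := by
  classical
  obtain ⟨A, hA, hAk⟩ := exists_alphak G k
  obtain ⟨s, hs, hsc⟩ := exists_cliqueNumber G
  obtain ⟨v, hv⟩ : ∃ v, v ∉ ⋃ i, A i := by
    by_contra! h
    have := card_inter_le_of_isClique hA (D := s.toFinset) (by simpa using hs) fun v _ => h v
    rw [← Set.ncard_eq_toFinset_card'] at this
    omega
  rw [← hAk, ← Set.ncard_insert_of_notMem hv]
  refine le_trans (le_of_eq ?_) (le_alphak (A := Fin.cons {v} A) ?_)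
  · congr 1
    ext w
    simp
  · intro i
    refine Fin.cases ?_ (fun i => ?_) i
    · rintro _ rfl _ rfl
      exact G.loopless.irrefl _
    · exact hA i

theorem PolyunsatG.cliqueNumber_le {G : SimpleGraph V} (hG : SGK G) (hp : PolyunsatG G) :
    cliqueNumber G ≤ alphak G 1 + 2 := by
  have step : ∀ k, 0 < k → k + 2 < cliqueNumber G →
      alphak G (k + 2) + alphak G k + 1 ≤ 2 * alphak G (k + 1) := by
    intro k hk hkc
    obtain ⟨f, hf, h1, h2⟩ := hG.exists_saturated hk
    have h3 : alphak G (k + 2) ≠ knorm f (k + 2) := fun h =>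
      hp k (k + 2) hk (by omega) (by omega) hkc (Or.inl le_rfl) ⟨f, hf, h1, h.symm⟩
    have := alphak_le_knorm hf (k + 2)
    have := knorm_concave f k
    omega
  have key : ∀ j k, 0 < k → k + j + 2 = cliqueNumber G →
      alphak G k + j + 1 ≤ alphak G (k + 1) := by
    intro j
    induction j with
    | zero => exact fun k _ hc => alphak_lt_succ (by omega)
    | succ j ih =>
      intro k hk hc
      have := ih (k + 1) (by omega) (by omega)
      have : alphak G (k + 2) + alphak G k + 1 ≤ 2 * alphak G (k + 1) := step k hk (by omega)
      simp only [add_assoc, Nat.reduceAdd] at *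
      omega
  by_contra! h
  obtain ⟨f, hf, h1, h2⟩ := hG.exists_saturated one_pos
  have h3 := key (cliqueNumber G - 3) 1 one_pos (by omega)
  have h4 := knorm_concave f 0
  have h5 : knorm f 0 = 0 := by simp [knorm]
  simp only [zero_add] at h4
  rw [h1] at h4
  simp only [Nat.reduceAdd] at *
  omega

end Necessity

section Construction

variable {V : Type*}

theorem isComparabilityGraph_fromRel {lt : V → V → Prop} (irrefl : ∀ v, ¬ lt v v)
    (trans : ∀ u v w, lt u v → lt v w → lt u w) :
    IsComparabilityGraph (SimpleGraph.fromRel lt) := by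
  refine isComparabilityGraph_of_strict lt irrefl trans fun v w => ?_
  rw [SimpleGraph.fromRel_adj, and_iff_right_of_imp]
  rintro h rfl
  exact irrefl v (by tauto)

/-- Two strict orders are conjugate when any two distinct elements are comparable in exactly one
of them; the comparability graph of the first is then co-comparability. -/
theorem compl_fromRel {lt lt' : V → V → Prop}
    (h : ∀ u v, u ≠ v → ((lt u v ∨ lt v u) ↔ ¬ (lt' u v ∨ lt' v u))) :
    (SimpleGraph.fromRel lt)ᶜ = SimpleGraph.fromRel lt' := by
  ext u v
  rw [SimpleGraph.compl_adj, SimpleGraph.fromRel_adj, SimpleGraph.fromRel_adj]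
  have := h u v
  tauto

theorem card_le_of_rank {lt : V → V → Prop} (r : V → ℕ) {l : ℕ} {D : Finset V}
    (hD : (SimpleGraph.fromRel lt).IsClique (D : Set V))
    (hr : ∀ v ∈ D, 1 ≤ r v ∧ r v ≤ l) (hlt : ∀ u ∈ D, ∀ v ∈ D, lt u v → r u < r v) :
    #D ≤ l := by
  have h : #D ≤ #(Finset.Icc 1 l) := by
    refine Finset.card_le_card_of_injOn r (fun v hv => by simpa using hr v hv) ?_
    intro u hu v hv huv
    by_contra hne
    rcases ((SimpleGraph.fromRel_adj _ _ _).1 (hD hu hv hne)).2 with h | h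
    · exact (hlt u hu v hv h).ne huv
    · exact (hlt v hv u hu h).ne huv.symm
  simpa using h

theorem cliqueNumber_le [Finite V] {G : SimpleGraph V} {l : ℕ}
    (h : ∀ D : Finset V, G.IsClique (D : Set V) → #D ≤ l) : cliqueNumber G ≤ l := by
  classical
  obtain ⟨s, hs, hsc⟩ := exists_cliqueNumber G
  have := Fintype.ofFinite V
  rw [← hsc, Set.ncard_eq_toFinset_card']
  exact h _ (by simpa using hs)

theorem card_le_cliqueNumber [Finite V] {G : SimpleGraph V} {D : Finset V}
    (hD : G.IsClique (D : Set V)) : #D ≤ cliqueNumber G := by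
  simpa using le_cliqueNumber hD

theorem card_fin_Ico (n p q : ℕ) : #{t : Fin n | p ≤ (t : ℕ) ∧ (t : ℕ) < q} = min q n - p := by
  rw [← Nat.card_Ico, ← Finset.card_map Fin.valEmbedding]
  congr 1
  ext i
  simp only [Finset.mem_map, Finset.mem_filter, Finset.mem_univ, true_and, Fin.valEmbedding_apply,
    Finset.mem_Ico, lt_min_iff]
  exact ⟨by rintro ⟨v, hv, rfl⟩; exact ⟨hv.1, hv.2, v.2⟩,
    fun h => ⟨⟨i, h.2.2⟩, ⟨h.1, h.2.1⟩, rfl⟩⟩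

/-- If a set `F` of vertices of maximal size `α_k` meets each clique in at most `k` vertices, then
it meets every class of a `k`-saturated clique partition in as many vertices as possible. -/
theorem card_inter_eq_of_saturated [Fintype V] [DecidableEq V] {G : SimpleGraph V} {f : V → V}
    {k : ℕ} (hf : IsCliquePartition G f) (hk : knorm f k = alphak G k) {F : Finset V}
    (hF : alphak G k ≤ #F)
    (hFc : ∀ D : Finset V, G.IsClique (D : Set V) → D ⊆ F → #D ≤ k) (i : V) :
    #{v ∈ F | f v = i} = min k #{v | f v = i} := by
  have hle : ∀ i ∈ (univ : Finset V), #{v ∈ F | f v = i} ≤ min k #{v | f v = i} := by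
    refine fun i _ => le_min (hFc _ ?_ (Finset.filter_subset _ _))
      (Finset.card_le_card fun v hv => by simpa using (Finset.mem_filter.1 hv).2)
    intro v hv w hw
    exact hf i (by simp_all) (by simp_all)
  refine (Finset.sum_eq_sum_iff_of_le hle).1 ?_ i (Finset.mem_univ i)
  refine (Finset.sum_le_sum hle).antisymm ?_
  rw [← Finset.card_eq_sum_card_fiberwise (fun _ _ => by simp)]
  refine le_trans (le_of_eq ?_) hF
  rw [← hk]
  exact Finset.sum_congr rfl fun i _ => by rw [ncard_fiber]

/-- Transporting a polyunsaturated graph to the vertex set `Fin n`. -/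
theorem exists_coPolyunsat [Fintype V] {H : SimpleGraph V} (h1 : IsComparabilityGraph H)
    (h2 : IsComparabilityGraph Hᶜ) (hp : PolyunsatG H) :
    ∃ (n : ℕ) (G : SimpleGraph (Fin n)),
      SGK G ∧ SGK Gᶜ ∧ PolyunsatG Gᶜ ∧ indepNumber G = cliqueNumber H ∧
        cliqueNumber G = indepNumber H ∧ IsComparabilityGraph G ∧ IsComparabilityGraph Gᶜ := by
  let e : H ≃g H.overFin rfl := H.overFinIso rfl
  have c1 : IsComparabilityGraph (H.overFin rfl) := h1.of_embedding e.symm.toEmbedding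
  have c2 : IsComparabilityGraph (H.overFin rfl)ᶜ :=
    h2.of_embedding (SimpleGraph.Embedding.complEquiv e.symm.toEmbedding)
  refine ⟨_, (H.overFin rfl)ᶜ, c2.sgk, ?_, ?_, ?_, ?_, c2, ?_⟩ <;> try rw [compl_compl]
  · exact c1.sgk
  · exact hp.iso e
  · rw [indepNumber_eq_cliqueNumber_compl, compl_compl, cliqueNumber_iso e]
  · rw [cliqueNumber_eq_indepNumber_compl, compl_compl, ← alphak_one, ← alphak_one, alphak_iso e]
  · exact c1

theorem exists_coPolyunsat_of_le_three {a c : ℕ} (ha : 0 < a) (hc : 0 < c) (ha3 : a ≤ 3) :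
    ∃ (n : ℕ) (G : SimpleGraph (Fin n)),
      SGK G ∧ SGK Gᶜ ∧ PolyunsatG Gᶜ ∧ indepNumber G = a ∧ cliqueNumber G = c ∧
        IsComparabilityGraph G ∧ IsComparabilityGraph Gᶜ := by
  let lt : Fin (a + c - 1) → Fin (a + c - 1) → Prop := fun u v => (u : ℕ) < v ∧ (v : ℕ) < a
  let lt' : Fin (a + c - 1) → Fin (a + c - 1) → Prop := fun u v => (u : ℕ) < v ∧ a ≤ (v : ℕ)
  have hcompl : (SimpleGraph.fromRel lt)ᶜ = SimpleGraph.fromRel lt' :=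
    compl_fromRel fun u v huv => by
      have := Fin.val_ne_of_ne huv
      simp only [lt, lt']
      omega
  have hω : cliqueNumber (SimpleGraph.fromRel lt) = a := by
    refine le_antisymm ?_ ?_
    · refine cliqueNumber_le fun D hD =>
        card_le_of_rank (fun v : Fin (a + c - 1) => if (v : ℕ) < a then v + 1 else 1) hD ?_ ?_
      · intro v _
        split_ifs <;> omega
      · rintro u - v - ⟨h1, h2⟩
        simp only [h2, h1.trans h2, if_true]
        omega
    · have hcard := card_fin_Ico (a + c - 1) 0 a
      rw [min_eq_left (by omega), Nat.sub_zero] at hcard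
      refine hcard.ge.trans (card_le_cliqueNumber fun u hu v hv huv => ?_)
      have := Fin.val_ne_of_ne huv
      simp only [Finset.coe_filter, Finset.mem_univ, true_and, Set.mem_ofPred_eq] at hu hv
      simp only [SimpleGraph.fromRel_adj, lt]
      exact ⟨huv, by omega⟩
  have hα : indepNumber (SimpleGraph.fromRel lt) = c := by
    rw [indepNumber_eq_cliqueNumber_compl, hcompl]
    refine le_antisymm ?_ ?_
    · refine cliqueNumber_le fun D hD =>
        card_le_of_rank (fun v : Fin (a + c - 1) => if (v : ℕ) < a then 1 else v + 2 - a) hD ?_ ?_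
      · intro v _
        split_ifs <;> omega
      · rintro u - v - ⟨h1, h2⟩
        split_ifs <;> omega
    · have hcard := card_fin_Ico (a + c - 1) (a - 1) (a + c - 1)
      rw [min_self, show a + c - 1 - (a - 1) = c by omega] at hcard
      refine hcard.ge.trans (card_le_cliqueNumber fun u hu v hv huv => ?_)
      have := Fin.val_ne_of_ne huv
      simp only [Finset.coe_filter, Finset.mem_univ, true_and, Set.mem_ofPred_eq] at hu hv
      simp only [SimpleGraph.fromRel_adj, lt']
      exact ⟨huv, by omega⟩
  have h := exists_coPolyunsat (H := SimpleGraph.fromRel lt)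
    (isComparabilityGraph_fromRel (fun v h => h.1.false) fun u v w h h' => ⟨h.1.trans h'.1, h'.2⟩)
    (hcompl ▸ isComparabilityGraph_fromRel (fun v h => h.1.false)
      fun u v w h h' => ⟨h.1.trans h'.1, h'.2⟩)
    (fun k l hk hl hkc hlc hkl => by omega)
  rwa [hω, hα] at h

end Construction

section Staircase

/-- The vertices of the staircase order: a chain `x 0 < ⋯ < x (m + 1)`, an antichain of `m - 1`
elements below, one chain of length `b` for each `b < m`, and `e` isolated vertices. -/
abbrev StairVertex (m e : ℕ) : Type :=
  (Fin (m + 2) ⊕ Fin (m - 1)) ⊕ ((Σ b : Fin m, Fin b) ⊕ Fin e)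

namespace StairVertex

variable {m e : ℕ}

/-- The elements of the main chain. -/
abbrev main (t : Fin (m + 2)) : StairVertex m e := Sum.inl (Sum.inl t)

/-- The minimal elements below the main chain. -/
abbrev low (i : Fin (m - 1)) : StairVertex m e := Sum.inl (Sum.inr i)

/-- The elements of the chains of lengths `b < m`. -/
abbrev row (b : Fin m) (s : Fin b) : StairVertex m e := Sum.inr (Sum.inl ⟨b, s⟩)

/-- The isolated elements. -/
abbrev iso (u : Fin e) : StairVertex m e := Sum.inr (Sum.inr u)

/-- The staircase order. -/
def lt : StairVertex m e → StairVertex m e → Prop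
  | Sum.inl (Sum.inl t), Sum.inl (Sum.inl t') => (t : ℕ) < t'
  | Sum.inl (Sum.inl t), Sum.inr (Sum.inl ⟨b, _⟩) => (t : ℕ) + b ≤ m
  | Sum.inl (Sum.inr i), Sum.inl (Sum.inl t) => (i : ℕ) + 1 < t
  | Sum.inl (Sum.inr i), Sum.inr (Sum.inl ⟨b, _⟩) => (i : ℕ) + 1 + b < m
  | Sum.inr (Sum.inl ⟨b, s⟩), Sum.inr (Sum.inl ⟨b', s'⟩) => (b : ℕ) = b' ∧ (s : ℕ) < s'
  | _, _ => False

/-- An order conjugate to the staircase order. -/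
def conj : StairVertex m e → StairVertex m e → Prop
  | Sum.inl (Sum.inl t), Sum.inr (Sum.inl ⟨b, _⟩) => m < (t : ℕ) + b
  | Sum.inl (Sum.inr i), Sum.inl (Sum.inl t) => (t : ℕ) ≤ i + 1
  | Sum.inl (Sum.inr i), Sum.inl (Sum.inr j) => (j : ℕ) < i
  | Sum.inl (Sum.inr i), Sum.inr (Sum.inl ⟨b, _⟩) => m ≤ (i : ℕ) + 1 + b
  | Sum.inr (Sum.inl ⟨b, _⟩), Sum.inr (Sum.inl ⟨b', _⟩) => (b : ℕ) < b'
  | Sum.inr (Sum.inr u), Sum.inr (Sum.inr v) => (u : ℕ) < v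
  | Sum.inr (Sum.inr _), Sum.inl _ => True
  | Sum.inr (Sum.inr _), Sum.inr (Sum.inl _) => True
  | _, _ => False

theorem lt_irrefl (v : StairVertex m e) : ¬ lt v v := by
  rcases v with (t | i) | (⟨b, s⟩ | u) <;> simp [lt]

theorem lt_trans (u v w : StairVertex m e) : lt u v → lt v w → lt u w := by
  rcases u with (t | i) | (⟨b, s⟩ | u) <;> rcases v with (t' | i') | (⟨b', s'⟩ | u') <;>
    rcases w with (t'' | i'') | (⟨b'', s''⟩ | u'') <;> intro h h' <;>
    simp only [lt] at h h' ⊢ <;> omega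

theorem conj_irrefl (v : StairVertex m e) : ¬ conj v v := by
  rcases v with (t | i) | (⟨b, s⟩ | u) <;> simp [conj]

theorem conj_trans (u v w : StairVertex m e) : conj u v → conj v w → conj u w := by
  rcases u with (t | i) | (⟨b, s⟩ | u) <;> rcases v with (t' | i') | (⟨b', s'⟩ | u') <;>
    rcases w with (t'' | i'') | (⟨b'', s''⟩ | u'') <;> intro h h' <;>
    simp only [conj] at h h' ⊢ <;> omega

theorem row_ext {b b' : Fin m} {s : Fin b} {s' : Fin b'} (hb : (b : ℕ) = b')
    (hs : (s : ℕ) = s') : (⟨b, s⟩ : Σ b : Fin m, Fin b) = ⟨b', s'⟩ := by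
  obtain rfl := Fin.ext hb
  rw [Fin.ext hs]

theorem lt_or_lt_iff (u v : StairVertex m e) (huv : u ≠ v) :
    (lt u v ∨ lt v u) ↔ ¬ (conj u v ∨ conj v u) := by
  rcases u with (t | i) | (⟨b, s⟩ | u) <;> rcases v with (t' | i') | (⟨b', s'⟩ | u')
  case inr.inl.inr.inl =>
    have : ¬ ((b : ℕ) = b' ∧ (s : ℕ) = s') := fun h => huv (by rw [row_ext h.1 h.2])
    simp only [lt, conj]
    omega
  all_goals
    simp only [ne_eq, Sum.inl.injEq, Sum.inr.injEq, Fin.ext_iff, reduceCtorEq] at huv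
    simp only [lt, conj, or_false, false_or, or_true, not_true_eq_false,
      not_false_eq_true, iff_true, false_iff] <;> omega

/-- The comparability graph of the staircase order. -/
def graph (m e : ℕ) : SimpleGraph (StairVertex m e) := SimpleGraph.fromRel lt

theorem adj_iff (u v : StairVertex m e) : (graph m e).Adj u v ↔ lt u v ∨ lt v u := by
  rw [graph, SimpleGraph.fromRel_adj, and_iff_right_of_imp]
  rintro h rfl
  exact lt_irrefl u (by tauto)

theorem isComparabilityGraph : IsComparabilityGraph (graph m e) :=
  isComparabilityGraph_fromRel lt_irrefl lt_trans

theorem isComparabilityGraph_compl : IsComparabilityGraph (graph m e)ᶜ := by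
  rw [graph, compl_fromRel lt_or_lt_iff]
  exact isComparabilityGraph_fromRel conj_irrefl conj_trans

/-- The total size of the chains of lengths `b < m`, each cut down to at most `k` elements. -/
def rowSum (m k : ℕ) : ℕ := ∑ b : Fin m, min k b

theorem rowSum_succ (m k : ℕ) : rowSum m (k + 1) = rowSum m k + (m - (k + 1)) := by
  have h := card_fin_Ico m (k + 1) m
  rw [min_self, Finset.card_filter] at h
  rw [rowSum, rowSum, ← h, ← Finset.sum_add_distrib]
  refine Finset.sum_congr rfl fun b _ => ?_
  have := b.2
  split_ifs <;> omega

/-- The number of vertices in a largest union of `k` antichains of the staircase order. -/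
def size (m e k : ℕ) : ℕ := e + m + (k - 1) + rowSum m (k - 1)

/-- A partition of the staircase order into chains that depends on a parameter `k`. -/
def colour (k : ℕ) (hm : 0 < m) : StairVertex m e → (Unit ⊕ Fin (m - 1)) ⊕ (Fin m ⊕ Fin e)
  | Sum.inl (Sum.inl t) =>
    if m ≤ min ((t : ℕ) - 1) (m - 1) + k then Sum.inl (Sum.inl ())
    else Sum.inr (Sum.inl ⟨m - 1 - min ((t : ℕ) - 1) (m - 1), by omega⟩)
  | Sum.inl (Sum.inr i) =>
    if m < (i : ℕ) + 1 + k then Sum.inl (Sum.inr i)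
    else if m = (i : ℕ) + 1 + k then Sum.inl (Sum.inl ())
    else Sum.inr (Sum.inl ⟨m - 1 - (i + 1), by omega⟩)
  | Sum.inr (Sum.inl ⟨b, _⟩) => Sum.inr (Sum.inl b)
  | Sum.inr (Sum.inr u) => Sum.inr (Sum.inr u)

theorem adj_of_colour {k : ℕ} (hm : 0 < m) (hk : 0 < k) {u v : StairVertex m e} (huv : u ≠ v)
    (h : colour k hm u = colour k hm v) : (graph m e).Adj u v := by
  rw [adj_iff]
  rcases u with (t | i) | (⟨b, s⟩ | u) <;> rcases v with (t' | i') | (⟨b', s'⟩ | u')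
  case inr.inl.inr.inl =>
    have : ¬ ((b : ℕ) = b' ∧ (s : ℕ) = s') := fun h => huv (by rw [row_ext h.1 h.2])
    simp only [colour, Sum.inr.injEq, Sum.inl.injEq, Fin.ext_iff] at h
    simp only [lt]
    omega
  all_goals
    simp only [ne_eq, Sum.inl.injEq, Sum.inr.injEq, Fin.ext_iff] at huv
    simp only [colour] at h
    simp only [lt]
    try split_ifs at h
    all_goals
      simp only [Sum.inl.injEq, Sum.inr.injEq, Fin.ext_iff, reduceCtorEq] at h <;> omega

theorem alphak_le {k : ℕ} (hm : 0 < m) (hk : 0 < k) (hkm : k ≤ m + 1) :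
    alphak (graph m e) k ≤ size m e k := by
  have h := alphak_le_sum (G := graph m e) (k := k) (colour k hm)
    (Sum.elim (Sum.elim (fun _ => k) fun i => if m - k ≤ (i : ℕ) ∧ (i : ℕ) < m then 1 else 0)
      (Sum.elim (fun b : Fin m => min k (b : ℕ)) fun _ => 1)) ?_
  · refine h.trans ?_
    simp only [Fintype.sum_sum_type, Sum.elim_inl, Sum.elim_inr, Finset.sum_const,
      Finset.card_univ, Fintype.card_unit, Fintype.card_fin, smul_eq_mul, one_mul, mul_one,
      ← Finset.card_filter, card_fin_Ico]
    obtain ⟨k, rfl⟩ := Nat.exists_eq_succ_of_ne_zero hk.ne'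
    have h1 := rowSum_succ m k
    simp only [size, rowSum, Nat.succ_eq_add_one, Nat.add_sub_cancel] at h1 ⊢
    omega
  · intro A hA c D hDA hDc
    have hclique : #D ≤ k := card_inter_le_of_isClique hA
      (fun u hu v hv huv => adj_of_colour hm hk huv ((hDc u hu).trans (hDc v hv).symm)) hDA
    rcases c with (_ | i) | (b | u)
    · exact hclique
    · have hD : ∀ v ∈ D, v = low i ∧ m < (i : ℕ) + 1 + k := by
        intro v hv
        have h := hDc v hv
        rcases v with (t | j) | (⟨b, s⟩ | u) <;> simp only [colour] at h
        all_goals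
          try split_ifs at h
        all_goals
          simp only [Sum.inl.injEq, Sum.inr.injEq, reduceCtorEq] at h
        subst h
        exact ⟨rfl, by assumption⟩
      simp only [Sum.elim_inl, Sum.elim_inr]
      split_ifs with hi
      · exact Finset.card_le_one.2 fun u hu v hv => (hD u hu).1.trans (hD v hv).1.symm
      · rw [Nat.le_zero, Finset.card_eq_zero, Finset.eq_empty_iff_forall_notMem]
        intro v hv
        have := (hD v hv).2
        omega
    · refine le_min hclique ?_
      rcases le_or_gt k b with hb | hb
      · exact hclique.trans hb
      · have hD : D ⊆ univ.image (row b) := by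
          intro v hv
          have h := hDc v hv
          rcases v with (t | j) | (⟨b, s⟩ | u) <;> simp only [colour] at h
          all_goals
            try split_ifs at h
          all_goals
            simp only [Sum.inl.injEq, Sum.inr.injEq, reduceCtorEq] at h
          · rw [← h] at hb
            simp only at hb
            omega
          · rw [← h] at hb
            simp only at hb
            omega
          · subst h
            exact Finset.mem_image_of_mem _ (Finset.mem_univ s)
        simpa using (Finset.card_le_card hD).trans Finset.card_image_le
    · refine Finset.card_le_one.2 fun v hv w hw => ?_
      have hD : ∀ v ∈ D, v = iso u := by
        intro v hv
        have h := hDc v hv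
        rcases v with (t | j) | (⟨b, s⟩ | u) <;> simp only [colour] at h
        all_goals
          try split_ifs at h
        all_goals
          simp only [Sum.inr.injEq, reduceCtorEq] at h
        rw [h]
      exact (hD v hv).trans (hD w hw).symm

/-- A union of `l` antichains of size `size m e l` that contains all the minimal elements and
misses the element `z` of the main chain. -/
def wide (m e l z : ℕ) : Finset (StairVertex m e) :=
  (({t | (t : ℕ) = 0 ∨ m + 2 ≤ (t : ℕ) + l ∧ (t : ℕ) ≠ z} : Finset (Fin (m + 2))).disjSum univ).disjSum
    ((univ.sigma fun b : Fin m => ({s | (b : ℕ) < s + l} : Finset (Fin b))).disjSum univ)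

/-- The rank of the elements of `wide m e l z`. -/
def wideRank (l z : ℕ) : StairVertex m e → ℕ
  | Sum.inl (Sum.inl t) =>
    if (t : ℕ) = 0 then 1 else if (t : ℕ) < z then t + l - m else t + l - m - 1
  | Sum.inr (Sum.inl ⟨b, s⟩) => l + 1 + s - b
  | _ => 1

theorem size_le_card_wide {l z : ℕ} (hm : 0 < m) (hl : 0 < l) (hzm : z ≤ m + 1) (hlm : l ≤ m + 1) :
    size m e l ≤ #(wide m e l z) := by
  have h1 : l ≤ #{t : Fin (m + 2) | (t : ℕ) = 0 ∨ m + 2 ≤ (t : ℕ) + l ∧ (t : ℕ) ≠ z} := by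
    have h := card_fin_Ico (m + 2) (m + 2 - l) (m + 2)
    rw [min_self] at h
    let I : Finset (Fin (m + 2)) := {t | m + 2 - l ≤ (t : ℕ) ∧ (t : ℕ) < m + 2 ∧ (t : ℕ) ≠ z}
    have h0 : (0 : Fin (m + 2)) ∉ I := by
      simp only [I, Finset.mem_filter, Fin.val_zero]
      omega
    have h1 : insert 0 I ⊆
        ({t | (t : ℕ) = 0 ∨ m + 2 ≤ (t : ℕ) + l ∧ (t : ℕ) ≠ z} : Finset (Fin (m + 2))) := by
      intro t
      simp only [I, Finset.mem_insert, Finset.mem_filter, Finset.mem_univ, true_and, Fin.ext_iff,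
        Fin.val_zero]
      omega
    have h2 : ({t | m + 2 - l ≤ (t : ℕ) ∧ (t : ℕ) < m + 2} : Finset (Fin (m + 2))) ⊆
        insert ⟨z, by omega⟩ I := by
      intro t
      simp only [I, Finset.mem_insert, Finset.mem_filter, Finset.mem_univ, true_and, Fin.ext_iff]
      omega
    have h2 := (Finset.card_le_card h2).trans (Finset.card_insert_le _ _)
    have h3 := Finset.card_le_card h1
    rw [Finset.card_insert_of_notMem h0] at h3
    omega
  have h2 : ∀ b : Fin m, #{s : Fin b | (b : ℕ) < s + l} = min (l - 1) b := by
    intro b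
    have h := card_fin_Ico b (b + 1 - l) b
    rw [min_self] at h
    rw [show min (l - 1) (b : ℕ) = b - (b + 1 - l) by omega, ← h]
    congr 1
    ext s
    simp only [Finset.mem_filter, Finset.mem_univ, true_and]
    omega
  simp only [wide, Finset.card_disjSum, Finset.card_sigma, h2, Finset.card_univ, Fintype.card_fin,
    size, rowSum]
  omega

theorem card_le_of_subset_wide {l z : ℕ} (hl : 0 < l) (hz : m + 2 ≤ z + l) (hzm : z ≤ m + 1)
    {D : Finset (StairVertex m e)} (hD : (graph m e).IsClique (D : Set (StairVertex m e)))
    (hDF : D ⊆ wide m e l z) : #D ≤ l := by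
  refine card_le_of_rank (wideRank l z) hD ?_ ?_
  · intro v hv
    have h := hDF hv
    rcases v with (t | j) | (⟨b, s⟩ | u) <;>
      simp only [wide, wideRank, Finset.inl_mem_disjSum, Finset.inr_mem_disjSum, Finset.mem_filter,
      Finset.mem_univ, true_and, Finset.mem_sigma] at h ⊢
    all_goals
      try split_ifs
    all_goals omega
  · intro u hu v hv
    have hu := hDF hu
    have hv := hDF hv
    rcases u with (t | i) | (⟨b, s⟩ | u) <;> rcases v with (t' | i') | (⟨b', s'⟩ | u') <;>
      intro h <;>
      simp only [wide, wideRank, lt, Finset.inl_mem_disjSum, Finset.inr_mem_disjSum, Finset.mem_filter,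
      Finset.mem_univ, true_and, Finset.mem_sigma] at hu hv h ⊢
    all_goals
      try split_ifs
    all_goals omega

/-- A union of `k` antichains of size `size m e k` that misses the top of the main chain. -/
def thin (m e k : ℕ) : Finset (StairVertex m e) :=
  (({t | m + 2 - k ≤ (t : ℕ) ∧ (t : ℕ) < m + 1} : Finset (Fin (m + 2))).disjSum
    ({i | m - 1 - k ≤ (i : ℕ) ∧ (i : ℕ) < m - 1} : Finset (Fin (m - 1)))).disjSum
    ((univ.sigma fun b : Fin m =>
      ({s | (b : ℕ) - k ≤ (s : ℕ) ∧ (s : ℕ) < b} : Finset (Fin b))).disjSum univ)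

/-- The rank of the elements of `thin m e k`. -/
def thinRank (k : ℕ) : StairVertex m e → ℕ
  | Sum.inl (Sum.inl t) => t + k - m
  | Sum.inr (Sum.inl ⟨b, s⟩) => k + 1 + s - b
  | _ => 1

theorem size_le_card_thin {k : ℕ} (hk : 0 < k) (hkm : k < m) : size m e k ≤ #(thin m e k) := by
  have h2 : ∀ b : Fin m, (b : ℕ) - (b - k) = min k b := fun b => by omega
  obtain ⟨k, rfl⟩ := Nat.exists_eq_succ_of_ne_zero hk.ne'
  have h1 := rowSum_succ m k
  simp only [thin, Finset.card_disjSum, Finset.card_sigma, card_fin_Ico, min_self, h2,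
    Finset.card_univ, Fintype.card_fin, size, rowSum, Nat.succ_eq_add_one,
    Nat.add_sub_cancel] at h1 ⊢
  omega

theorem card_le_of_subset_thin {k : ℕ} (hk : 0 < k) (hkm : k < m)
    {D : Finset (StairVertex m e)} (hD : (graph m e).IsClique (D : Set (StairVertex m e)))
    (hDF : D ⊆ thin m e k) : #D ≤ k := by
  refine card_le_of_rank (thinRank k) hD ?_ ?_
  · intro v hv
    have h := hDF hv
    rcases v with (t | j) | (⟨b, s⟩ | u) <;>
      simp only [thin, thinRank, Finset.inl_mem_disjSum, Finset.inr_mem_disjSum, Finset.mem_filter,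
      Finset.mem_univ, true_and, Finset.mem_sigma] at h ⊢ <;> omega
  · intro u hu v hv
    have hu := hDF hu
    have hv := hDF hv
    rcases u with (t | i) | (⟨b, s⟩ | u) <;> rcases v with (t' | i') | (⟨b', s'⟩ | u') <;>
      intro h <;>
      simp only [thin, thinRank, lt, Finset.inl_mem_disjSum, Finset.inr_mem_disjSum, Finset.mem_filter,
      Finset.mem_univ, true_and, Finset.mem_sigma] at hu hv h ⊢ <;> omega

/-- The rank of an element of the staircase order. -/
def rank : StairVertex m e → ℕ
  | Sum.inl (Sum.inl t) => t + 1
  | Sum.inr (Sum.inl ⟨b, s⟩) => m + 3 + s - b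
  | _ => 1

theorem cliqueNumber_graph : cliqueNumber (graph m e) = m + 2 := by
  refine le_antisymm (cliqueNumber_le fun D hD => card_le_of_rank rank hD ?_ ?_) ?_
  · intro v _
    rcases v with (t | j) | (⟨b, s⟩ | u) <;> simp only [rank] <;> omega
  · intro u _ v _
    rcases u with (t | i) | (⟨b, s⟩ | u) <;> rcases v with (t' | i') | (⟨b', s'⟩ | u') <;>
      intro h <;> simp only [lt] at h <;> simp only [rank] <;> omega
  · have h : #(((univ : Finset (Fin (m + 2))).disjSum (∅ : Finset (Fin (m - 1)))).disjSum
        (∅ : Finset ((Σ b : Fin m, Fin b) ⊕ Fin e))) = m + 2 := by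
      simp
    refine h.ge.trans (card_le_cliqueNumber fun u hu v hv huv => ?_)
    rw [adj_iff]
    rcases u with (t | i) | u <;> rcases v with (t' | i') | v <;> simp at hu hv huv
    simp only [lt]
    omega

theorem indepNumber_graph (hm : 0 < m) : indepNumber (graph m e) = m + e := by
  refine le_antisymm ?_ ?_
  · rw [← alphak_one]
    refine (alphak_le hm one_pos (by omega)).trans (le_of_eq ?_)
    simp [size, rowSum, add_comm]
  · rw [indepNumber_eq_cliqueNumber_compl]
    have h : #((({0} : Finset (Fin (m + 2))).disjSum (univ : Finset (Fin (m - 1)))).disjSum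
        ((∅ : Finset (Σ b : Fin m, Fin b)).disjSum (univ : Finset (Fin e)))) = m + e := by
      simp only [Finset.card_disjSum, Finset.card_singleton, Finset.card_empty, Finset.card_univ,
        Fintype.card_fin]
      omega
    refine h.ge.trans (card_le_cliqueNumber ?_)
    rw [← indepSet_iff_isClique_compl]
    intro u hu v hv
    rw [adj_iff]
    rcases u with (t | i) | (⟨b, s⟩ | u) <;> rcases v with (t' | i') | (⟨b', s'⟩ | u') <;>
      simp at hu hv <;> simp_all [lt]

theorem not_saturated_of_saturated {k l : ℕ} (hk : 0 < k) (hkl : k + 2 ≤ l) (hlm : l ≤ m + 1)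
    {f : StairVertex m e → StairVertex m e} (hf : IsCliquePartition (graph m e) f)
    (hfk : knorm f k = alphak (graph m e) k) : knorm f l ≠ alphak (graph m e) l := by
  intro hfl
  have hm : 0 < m := by omega
  set x : StairVertex m e := main (Fin.last _) with hx
  set y : StairVertex m e := main ⟨m + 2 - l, by omega⟩ with hy
  have hw : ∀ z, m + 2 ≤ z + l → z ≤ m + 1 →
      #{v ∈ wide m e l z | f v = f x} = min l #{v | f v = f x} := fun z hz hzm =>
    card_inter_eq_of_saturated hf hfl
      ((alphak_le hm (by omega) hlm).trans (size_le_card_wide hm (by omega) hzm hlm))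
      (fun D hD hDF => card_le_of_subset_wide (by omega) hz hzm hD hDF) _
  have ht : #{v ∈ thin m e k | f v = f x} = min k #{v | f v = f x} :=
    card_inter_eq_of_saturated hf hfk
      ((alphak_le hm hk (by omega)).trans (size_le_card_thin hk (by omega)))
      (fun D hD hDF => card_le_of_subset_thin hk (by omega) hD hDF) _
  have hwx := hw (m + 1) (by omega) le_rfl
  have hwy := hw (m + 2 - l) (by omega) (by omega)
  have hxx : x ∉ wide m e l (m + 1) := by
    simp only [wide, hx, Finset.inl_mem_disjSum, Finset.mem_filter, Fin.val_last]
    omega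
  have hlt : #{v ∈ wide m e l (m + 1) | f v = f x} < #{v | f v = f x} := by
    refine Finset.card_lt_card ⟨fun v hv => by simpa using (Finset.mem_filter.1 hv).2, fun h => ?_⟩
    exact hxx (Finset.mem_filter.1 (h (Finset.mem_filter.2 ⟨Finset.mem_univ x, rfl⟩))).1
  have hyx : f y = f x := by
    by_contra hne
    have hsub : insert x {v ∈ wide m e l (m + 1) | f v = f x} ⊆
        {v ∈ wide m e l (m + 2 - l) | f v = f x} := by
      intro v hv
      rw [Finset.mem_insert, Finset.mem_filter] at hv
      rw [Finset.mem_filter]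
      rcases hv with rfl | ⟨hv, hfv⟩
      · refine ⟨?_, rfl⟩
        simp only [wide, hx, Finset.inl_mem_disjSum, Finset.mem_filter, Finset.mem_univ, true_and,
          Fin.val_last]
        omega
      · refine ⟨?_, hfv⟩
        have hvy : v ≠ y := fun h => hne (h ▸ hfv)
        rcases v with (t | i) | (⟨b, s⟩ | u) <;>
          simp only [wide, hy, ne_eq, Sum.inl.injEq, Fin.ext_iff, Finset.inl_mem_disjSum,
            Finset.inr_mem_disjSum, Finset.mem_filter, Finset.mem_univ, true_and,
            Finset.mem_sigma] at hv hvy ⊢ <;>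
          omega
    have := Finset.card_le_card hsub
    rw [Finset.card_insert_of_notMem fun h => hxx (Finset.mem_filter.1 h).1] at this
    omega
  have hthin : #{v ∈ thin m e k | f v = f x} ≤ k - 1 := by
    have hclique := hf (f x)
    have h : #{v ∈ thin m e k | f v = f x} ≤
        #(({t | m + 2 - k ≤ (t : ℕ) ∧ (t : ℕ) < m + 1} : Finset (Fin (m + 2))).image
          (main (e := e))) := by
      refine Finset.card_le_card fun v hv => ?_
      rw [Finset.mem_filter] at hv
      obtain ⟨hv, hfv⟩ := hv
      have hvx : v ≠ x → lt v x ∨ lt x v := fun h => (adj_iff _ _).1 (hclique hfv rfl h)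
      have hvy : v ≠ y → lt v y ∨ lt y v := fun h => (adj_iff _ _).1 (hclique hfv hyx h)
      rcases v with (t | i) | (⟨b, s⟩ | u)
      · refine Finset.mem_image_of_mem _ ?_
        simpa [thin] using hv
      all_goals
        exfalso
        replace hvx := hvx (by simp [hx])
        replace hvy := hvy (by simp [hy])
        simp only [lt, hx, hy, thin, Finset.inl_mem_disjSum,
            Finset.inr_mem_disjSum, Finset.mem_filter, Finset.mem_univ, true_and,
            Finset.mem_sigma, Fin.val_last, or_false, false_or, or_self] at hv hvx hvy
        try omega
    refine (h.trans Finset.card_image_le).trans ?_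
    rw [card_fin_Ico]
    omega
  omega

theorem polyunsatG : PolyunsatG (graph m e) := by
  intro k l hk hl hkc hlc hkl
  rw [cliqueNumber_graph] at hkc hlc
  rintro ⟨f, hf, h1, h2⟩
  rcases hkl with hkl | hkl
  · exact not_saturated_of_saturated hk hkl (by omega) hf h1 h2
  · exact not_saturated_of_saturated hl hkl (by omega) hf h2 h1

end StairVertex

end Staircase

theorem exists_coPolyunsat_of_le {a c : ℕ} (ha : 0 < a) (hc : 0 < c) (hac : a ≤ c + 2) :
    ∃ (n : ℕ) (G : SimpleGraph (Fin n)),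
      SGK G ∧ SGK Gᶜ ∧ PolyunsatG Gᶜ ∧ indepNumber G = a ∧ cliqueNumber G = c ∧
        IsComparabilityGraph G ∧ IsComparabilityGraph Gᶜ := by
  rcases le_or_gt a 3 with ha3 | ha3
  · exact exists_coPolyunsat_of_le_three ha hc ha3
  · obtain ⟨m, rfl⟩ := Nat.exists_eq_add_of_le' (show 2 ≤ a by omega)
    obtain ⟨e, rfl⟩ := Nat.exists_eq_add_of_le (show m ≤ c by omega)
    have h := exists_coPolyunsat StairVertex.isComparabilityGraph
      (StairVertex.isComparabilityGraph_compl (m := m) (e := e)) StairVertex.polyunsatG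
    rwa [StairVertex.cliqueNumber_graph, StairVertex.indepNumber_graph (by omega)] at h

/-- For positive integers `a` and `c`: there is a co-polyunsaturated SGK graph with
independence number `a` and clique number `c` iff `c ≥ a - 2`; moreover, in that case the
graph may be chosen so that it and its complement are comparability graphs. -/
theorem statement17 (a c : ℕ) (ha : 0 < a) (hc : 0 < c) :
    ((∃ (n : ℕ) (G : SimpleGraph (Fin n)),
        SGK G ∧ SGK Gᶜ ∧ PolyunsatG Gᶜ ∧ indepNumber G = a ∧ cliqueNumber G = c) ↔
      a ≤ c + 2) ∧
    (a ≤ c + 2 →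
      ∃ (n : ℕ) (G : SimpleGraph (Fin n)),
        SGK G ∧ SGK Gᶜ ∧ PolyunsatG Gᶜ ∧ indepNumber G = a ∧ cliqueNumber G = c ∧
        IsComparabilityGraph G ∧ IsComparabilityGraph Gᶜ) := by
  refine ⟨⟨?_, fun h => ?_⟩, exists_coPolyunsat_of_le ha hc⟩
  · rintro ⟨n, G, -, hG, hp, rfl, rfl⟩
    rw [indepNumber_eq_cliqueNumber_compl, cliqueNumber_eq_indepNumber_compl G, ← alphak_one]
    exact hp.cliqueNumber_le hG
  · obtain ⟨n, G, h1, h2, h3, h4, h5, -⟩ := exists_coPolyunsat_of_le ha hc h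
    exact ⟨n, G, h1, h2, h3, h4, h5⟩
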